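/- arXiv:1408.1585 — 6 statements merged into one kernel-verified Lean document; each statement's English description precedes it below -/
import Mathlib

section
/- Let 𝕀 = (I, ≤, 𝓘) be a set of indices and let 𝓑 ⊆ ℝ^I. Then the following are equivalent: (a) for all i, j ∈ 𝓑 there exists s ∈ 𝓑 with s >_𝕀 0 and (|i_ε| + |j_ε|)_ε = O(s); (b) for all i, j ∈ 𝓑 there exists s ∈ 𝓑 with (i_ε + j_ε)_ε = O(s), and for all i ∈ 𝓑 there exists a ∈ 𝓑 with a >_𝕀 0 and i = O(a). -/
open MeasureTheory

/-- Strict order relation used in the paper: `x < y` iff `x ≤ y` and `x ≠ y`. -/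
def sLT {I : Type*} [Preorder I] (x y : I) : Prop := x ≤ y ∧ x ≠ y

/-- A set of indices `𝕀 = (I, ≤, 𝓘)` in the sense of Giordano–Luperi Baglini. -/
structure SetOfIndices (I : Type*) [Preorder I] where
  sets : Set (Set I)
  empty_not_mem : (∅ : Set I) ∉ sets
  univ_mem : (Set.univ : Set I) ∈ sets
  inter_sub : ∀ A ∈ sets, ∀ B ∈ sets, ∃ C ∈ sets, C ⊆ A ∩ B
  downward : ∀ A ∈ sets, ∀ a ∈ A, ∀ e, e ≤ a →
    ((∃ ε, ε ∈ A ∧ ε ≤ e) ∧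
      (∀ b ∈ A, b ≤ e → ∀ c ∈ A, c ≤ e →
        ∃ d, d ∈ A ∧ d ≤ e ∧ sLT d b ∧ sLT d c))

section Defs

variable {I : Type*} [Preorder I]

/-- `x = O_{a,A}(y)`. -/
def BigOaA (A : Set I) (a : I) (x y : I → ℝ) : Prop :=
  ∃ H : ℝ, 0 < H ∧ ∃ ε₀, ε₀ ∈ A ∧ ε₀ ≤ a ∧ ∀ ε ∈ A, ε ≤ ε₀ → |x ε| ≤ H * |y ε|

/-- `x = O_𝒥(y)` for a family `𝒥` of subsets of `I`. -/
def BigOJ (J : Set (Set I)) (x y : I → ℝ) : Prop :=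
  ∃ A ∈ J, ∀ a ∈ A, BigOaA A a x y

/-- `x = O(y)` (i.e. `O_𝓘`). -/
def BigO (S : SetOfIndices I) (x y : I → ℝ) : Prop := BigOJ S.sets x y

/-- `i >_𝕀 j`. -/
def gtI (S : SetOfIndices I) (i j : I → ℝ) : Prop :=
  ∃ A ∈ S.sets, ∀ a ∈ A, ∃ e, e ∈ A ∧ e ≤ a ∧ ∀ ε ∈ A, ε ≤ e → j ε < i ε

/-- `P(ε)` holds for `ε` sufficiently small in `𝕀`. -/
def EventuallyI (S : SetOfIndices I) (P : I → Prop) : Prop :=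
  ∃ A ∈ S.sets, ∀ a ∈ A, ∃ e, e ∈ A ∧ e ≤ a ∧ ∀ ε ∈ A, ε ≤ e → P ε

/-- `lim_𝕀 f = l` for a finite limit `l ∈ ℝ`. -/
def limEq (S : SetOfIndices I) (f : I → ℝ) (l : ℝ) : Prop :=
  ∃ A ∈ S.sets, ∀ a ∈ A, ∀ r : ℝ, 0 < r →
    ∃ a₀, a₀ ≤ a ∧ ∀ ε ∈ A, ε ≤ a₀ → |l - f ε| < r

/-- `lim_𝕀 f = ∞` (unsigned infinity). -/
def limInfinite (S : SetOfIndices I) (f : I → ℝ) : Prop :=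
  ∃ A ∈ S.sets, ∀ a ∈ A, ∀ R : ℝ, 0 < R →
    ∃ a₀, a₀ ≤ a ∧ ∀ ε ∈ A, ε ≤ a₀ → R < |f ε|

/-- `lim_𝕀 f = +∞`. -/
def limPInf (S : SetOfIndices I) (f : I → ℝ) : Prop :=
  ∃ A ∈ S.sets, ∀ a ∈ A, ∀ R : ℝ, 0 < R →
    ∃ a₀, a₀ ≤ a ∧ ∀ ε ∈ A, ε ≤ a₀ → R < f ε

/-- `𝓑` is an asymptotic gauge on the set of indices `S`. -/
structure IsAG (S : SetOfIndices I) (B : Set (I → ℝ)) : Prop where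
  infinite : ∃ i ∈ B, limInfinite S i
  mul : ∀ i ∈ B, ∀ j ∈ B, ∃ p ∈ B, BigO S (fun ε => i ε * j ε) p
  smul : ∀ i ∈ B, ∀ r : ℝ, ∃ σ ∈ B, BigO S (fun ε => r * i ε) σ
  absAdd : ∀ i ∈ B, ∀ j ∈ B, ∃ s ∈ B, gtI S s (fun _ => 0) ∧
    BigO S (fun ε => |i ε| + |j ε|) s

/-- `𝓑_{>0}`, the positive part of `𝓑`. -/
def agPos (S : SetOfIndices I) (B : Set (I → ℝ)) : Set (I → ℝ) :=
  {i ∈ B | gtI S i (fun _ => 0)}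

/-- `ℝ_M(𝓑)`, the moderate nets generated by `𝓑`. -/
def RM (S : SetOfIndices I) (B : Set (I → ℝ)) : Set (I → ℝ) :=
  {x | ∃ b ∈ B, BigO S x b}

/-- `sup_{x ∈ K} |f x|`. -/
noncomputable def supAbsOn {X : Type*} (K : Set X) (f : X → ℝ) : ℝ :=
  sSup ((fun x => |f x|) '' K)

/-- Partial derivative of `f : ℝⁿ → ℝ` in the `i`-th coordinate direction. -/
noncomputable def pDeriv {n : ℕ} (i : Fin n) (f : (Fin n → ℝ) → ℝ) :
    (Fin n → ℝ) → ℝ :=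
  fun x => fderiv ℝ f x (Pi.single i 1)

/-- Iterated partial derivative `∂^α f` along a list of coordinate directions
(the list encodes the multi-index `α ∈ ℕⁿ`). -/
noncomputable def multiDeriv {n : ℕ} : List (Fin n) → ((Fin n → ℝ) → ℝ) → ((Fin n → ℝ) → ℝ)
  | [], f => f
  | i :: l, f => multiDeriv l (pDeriv i f)

/-- `ℰ_M(𝓑,Ω)`: the `𝓑`-moderate nets of smooth functions on `Ω ⊆ ℝⁿ`. -/
def EMod (S : SetOfIndices I) (B : Set (I → ℝ)) {n : ℕ} (Ω : Set (Fin n → ℝ))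
    (u : I → (Fin n → ℝ) → ℝ) : Prop :=
  ∀ K : Set (Fin n → ℝ), K ⊆ Ω → IsCompact K → ∀ l : List (Fin n),
    ∃ b ∈ B, BigO S (fun ε => supAbsOn K (multiDeriv l (u ε))) b

/-- `𝒩(𝒵,Ω)`: the `𝒵`-negligible nets of smooth functions on `Ω ⊆ ℝⁿ`. -/
def NNeg (S : SetOfIndices I) (Z : Set (I → ℝ)) {n : ℕ} (Ω : Set (Fin n → ℝ))
    (u : I → (Fin n → ℝ) → ℝ) : Prop :=
  ∀ K : Set (Fin n → ℝ), K ⊆ Ω → IsCompact K → ∀ l : List (Fin n),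
    ∀ z ∈ agPos S Z,
      BigO S (fun ε => supAbsOn K (multiDeriv l (u ε))) (fun ε => (z ε)⁻¹)

/-- One–dimensional version of `ℰ_M(𝓑,ℝ)`, using iterated derivatives. -/
def EM1 (S : SetOfIndices I) (B : Set (I → ℝ)) (u : I → ℝ → ℝ) : Prop :=
  ∀ K : Set ℝ, IsCompact K → ∀ k : ℕ,
    ∃ b ∈ B, BigO S (fun ε => supAbsOn K (iteratedDeriv k (u ε))) b

/-- One–dimensional version of `𝒩(𝒵,ℝ)`, using iterated derivatives. -/
def NEG1 (S : SetOfIndices I) (Z : Set (I → ℝ)) (u : I → ℝ → ℝ) : Prop :=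
  ∀ K : Set ℝ, IsCompact K → ∀ k : ℕ, ∀ z ∈ agPos S Z,
    BigO S (fun ε => supAbsOn K (iteratedDeriv k (u ε))) (fun ε => (z ε)⁻¹)

/-- `AG(b) = {b^m ∣ m ∈ ℕ}`, the principal asymptotic gauge generated by `b`. -/
def AGpow (b : I → ℝ) : Set (I → ℝ) := {g | ∃ m : ℕ, g = fun ε => (b ε) ^ m}

/-- `e^𝓑 = {e^{H·b} ∣ H > 0, b ∈ 𝓑}`, the exponential of the asymptotic gauge `𝓑`. -/
def expAG (B : Set (I → ℝ)) : Set (I → ℝ) :=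
  {g | ∃ H : ℝ, 0 < H ∧ ∃ b ∈ B, g = fun ε => Real.exp (H * b ε)}

end Defs

/-- The property `P p ε` holds for `ε` sufficiently small in some `A ∈ 𝓘`, with a parameter `p`
that may depend on the point of `A` below which smallness is measured. -/
def EventuallyParam {I : Type*} [Preorder I] {ι : Type*} (S : SetOfIndices I)
    (P : ι → I → Prop) : Prop :=
  ∃ A ∈ S.sets, ∀ a ∈ A, ∃ p, ∃ e ∈ A, e ≤ a ∧ ∀ ε ∈ A, ε ≤ e → P p ε

section

variable {I : Type*} [Preorder I] {S : SetOfIndices I}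

theorem EventuallyParam.and {ι κ : Type*} {P : ι → I → Prop} {Q : κ → I → Prop}
    (hP : EventuallyParam S P) (hQ : EventuallyParam S Q) :
    EventuallyParam S (fun (r : ι × κ) ε => P r.1 ε ∧ Q r.2 ε) := by
  obtain ⟨A, hA, hP⟩ := hP
  obtain ⟨B, hB, hQ⟩ := hQ
  obtain ⟨C, hC, hCAB⟩ := S.inter_sub A hA B hB
  refine ⟨C, hC, fun c hc => ?_⟩
  obtain ⟨p, e, -, hec, hPe⟩ := hP c (hCAB hc).1
  obtain ⟨q, f, -, hfc, hQf⟩ := hQ c (hCAB hc).2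
  obtain ⟨⟨e', he', hee⟩, -⟩ := S.downward C hC c hc e hec
  obtain ⟨⟨f', hf', hff⟩, -⟩ := S.downward C hC c hc f hfc
  obtain ⟨d, hd, hdc, hde, hdf⟩ :=
    (S.downward C hC c hc c le_rfl).2 e' he' (hee.trans hec) f' hf' (hff.trans hfc)
  exact ⟨(p, q), d, hd, hdc, fun ε hε hεd =>
    ⟨hPe ε (hCAB hε).1 (hεd.trans (hde.1.trans hee)),
      hQf ε (hCAB hε).2 (hεd.trans (hdf.1.trans hff))⟩⟩

theorem EventuallyParam.imp {ι κ : Type*} {P : ι → I → Prop} {Q : κ → I → Prop}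
    (hP : EventuallyParam S P) (f : ι → κ) (h : ∀ p ε, P p ε → Q (f p) ε) :
    EventuallyParam S Q := by
  obtain ⟨A, hA, hP⟩ := hP
  refine ⟨A, hA, fun a ha => ?_⟩
  obtain ⟨p, e, he, hea, hPe⟩ := hP a ha
  exact ⟨f p, e, he, hea, fun ε hε hεe => h p ε (hPe ε hε hεe)⟩

theorem bigO_iff_eventuallyParam {x y : I → ℝ} :
    BigO S x y ↔ EventuallyParam S (fun (H : ℝ) ε => 0 < H ∧ |x ε| ≤ H * |y ε|) := by
  constructor
  · rintro ⟨A, hA, h⟩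
    refine ⟨A, hA, fun a ha => ?_⟩
    obtain ⟨H, hH, e, he, hea, hb⟩ := h a ha
    exact ⟨H, e, he, hea, fun ε hε hεe => ⟨hH, hb ε hε hεe⟩⟩
  · rintro ⟨A, hA, h⟩
    refine ⟨A, hA, fun a ha => ?_⟩
    obtain ⟨H, e, he, hea, hb⟩ := h a ha
    exact ⟨H, (hb e he le_rfl).1, e, he, hea, fun ε hε hεe => (hb ε hε hεe).2⟩

theorem gtI.eventuallyParam {x y : I → ℝ} (h : gtI S x y) :
    EventuallyParam S (fun (_ : Unit) ε => y ε < x ε) := by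
  obtain ⟨A, hA, h⟩ := h
  exact ⟨A, hA, fun a ha => ⟨(), h a ha⟩⟩

theorem BigO.of_abs_le {x y z : I → ℝ} (hy : BigO S y z) (h : ∀ ε, |x ε| ≤ |y ε|) :
    BigO S x z :=
  bigO_iff_eventuallyParam.2 <| (bigO_iff_eventuallyParam.1 hy).imp id
    fun _ ε hH => ⟨hH.1, (h ε).trans hH.2⟩

theorem BigO.trans {x y z : I → ℝ} (hxy : BigO S x y) (hyz : BigO S y z) : BigO S x z := by
  rw [bigO_iff_eventuallyParam] at *
  refine (hxy.and hyz).imp (fun r => r.1 * r.2) ?_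
  rintro ⟨H, K⟩ ε ⟨⟨hH, hx⟩, hK, hy⟩
  refine ⟨mul_pos hH hK, hx.trans ?_⟩
  rw [mul_assoc]
  exact mul_le_mul_of_nonneg_left hy hH.le

theorem BigO.abs_add_abs {x y u v : I → ℝ} (hx : BigO S x u) (hy : BigO S y v)
    (hu : gtI S u (fun _ => 0)) (hv : gtI S v (fun _ => 0)) :
    BigO S (fun ε => |x ε| + |y ε|) (fun ε => u ε + v ε) := by
  rw [bigO_iff_eventuallyParam] at *
  refine ((hx.and hy).and (hu.eventuallyParam.and hv.eventuallyParam)).imp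
    (fun r => r.1.1 + r.1.2) ?_
  rintro ⟨⟨H, K⟩, _⟩ ε ⟨⟨⟨hH, hxε⟩, hK, hyε⟩, huε, hvε⟩
  dsimp only at hxε hyε ⊢
  rw [abs_of_pos huε] at hxε
  rw [abs_of_pos hvε] at hyε
  refine ⟨add_pos hH hK, ?_⟩
  rw [abs_of_nonneg (by positivity), abs_of_pos (add_pos huε hvε)]
  nlinarith [mul_pos hH hvε, mul_pos hK huε]

end

/-- equivalent formulation of the sum/absolute-value closure axiom
of asymptotic gauges (Lem. `AGabsSum` of the paper). -/
theorem absSum_closure_iff {I : Type*} [Preorder I] (S : SetOfIndices I)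
    (B : Set (I → ℝ)) :
    (∀ i ∈ B, ∀ j ∈ B, ∃ s ∈ B, gtI S s (fun _ => 0) ∧
        BigO S (fun ε => |i ε| + |j ε|) s) ↔
      ((∀ i ∈ B, ∀ j ∈ B, ∃ s ∈ B, BigO S (fun ε => i ε + j ε) s) ∧
        (∀ i ∈ B, ∃ a ∈ B, gtI S a (fun _ => 0) ∧ BigO S i a)) := by
  constructor
  · intro h
    refine ⟨fun i hi j hj => ?_, fun i hi => ?_⟩
    · obtain ⟨s, hs, -, hO⟩ := h i hi j hj
      exact ⟨s, hs, hO.of_abs_le fun ε => (abs_add_le _ _).trans (le_abs_self _)⟩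
    · obtain ⟨s, hs, hpos, hO⟩ := h i hi i hi
      exact ⟨s, hs, hpos, hO.of_abs_le fun ε =>
        (le_add_of_nonneg_right (abs_nonneg _)).trans (le_abs_self _)⟩
  · rintro ⟨hadd, hdom⟩ i hi j hj
    obtain ⟨u, hu, hu0, hiu⟩ := hdom i hi
    obtain ⟨v, hv, hv0, hjv⟩ := hdom j hj
    obtain ⟨t, ht, huvt⟩ := hadd u hu v hv
    obtain ⟨s, hs, hs0, hts⟩ := hdom t ht
    exact ⟨s, hs, hs0, ((hiu.abs_add_abs hjv hu0 hv0).trans huvt).trans hts⟩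
end

section
/- Let 𝕀 = (I, ≤, 𝓘) be a set of indices and let ρ : I → (0,1] be a map with lim_𝕀 ρ = 0. Let 𝓑 be an asymptotic gauge on the set of indices 𝕀ˢ := ((0,1], ≤, 𝓘ˢ) (with the usual order on (0,1] and 𝓘ˢ := {(0,ε₀] | ε₀ ∈ (0,1]}). Define 𝓑 ∘ ρ := {i ∘ ρ | i ∈ 𝓑}. Then: (1) 𝓑 ∘ ρ is an asymptotic gauge on 𝕀; (2) if every i ∈ 𝓑 satisfies i >_{𝕀ˢ} 0, then every element of 𝓑 ∘ ρ satisfies (i ∘ ρ) >_𝕀 0; (3) if 𝓑 is totally ordered (for all i, j ∈ 𝓑, either i = O(j) or j = O(i) with respect to 𝕀ˢ), then 𝓑 ∘ ρ is totally ordered with respect to 𝕀. -/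
open MeasureTheory

/-- The index set `I^s = (0,1]` of the special Colombeau algebra. -/
abbrev Isp : Type := {x : ℝ // x ∈ Set.Ioc (0 : ℝ) 1}

/-- The family `𝓘^s = {(0,ε₀] ∣ ε₀ ∈ (0,1]}`. -/
def specialSets : Set (Set Isp) := {A | ∃ e : Isp, A = {x : Isp | x ≤ e}}

/-- A property of the points of `(0, e]` holds along an infinitesimal net, uniformly on one set of
the target family. -/
theorem eventuallyI_comp_of_forall_le {I : Type*} [Preorder I] {S : SetOfIndices I} {ρ : I → Isp}
    (hρ : limEq S (fun ε => (ρ ε : ℝ)) 0) {P : Isp → Prop} {e : Isp} (he : ∀ x ≤ e, P x) :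
    EventuallyI S (fun ε => P (ρ ε)) := by
  obtain ⟨A, hA, hlim⟩ := hρ
  refine ⟨A, hA, fun a ha => ?_⟩
  obtain ⟨a₀, ha₀, h⟩ := hlim a ha e e.2.1
  obtain ⟨ε₀, hε₀, hle⟩ := (S.downward A hA a ha a₀ ha₀).1
  refine ⟨ε₀, hε₀, hle.trans ha₀, fun ε hε hεle => he _ ?_⟩
  have hlt := h ε hε (hεle.trans hle)
  rw [zero_sub, abs_neg] at hlt
  exact Subtype.coe_le_coe.mp ((le_abs_self _).trans hlt.le)

theorem EventuallyI.exists_forall_le {Ssp : SetOfIndices Isp} (hSsp : Ssp.sets = specialSets)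
    {P : Isp → Prop} (h : EventuallyI Ssp P) : ∃ e, ∀ x ≤ e, P x := by
  obtain ⟨A, hA, h⟩ := h
  rw [hSsp] at hA
  obtain ⟨a, rfl⟩ := hA
  obtain ⟨e, -, hea, he⟩ := h a (le_refl a)
  exact ⟨e, fun x hx => he x (hx.trans hea) hx⟩

theorem gtI.comp_infinitesimal {I : Type*} [Preorder I] {S : SetOfIndices I}
    {Ssp : SetOfIndices Isp} (hSsp : Ssp.sets = specialSets) {ρ : I → Isp}
    (hρ : limEq S (fun ε => (ρ ε : ℝ)) 0) {i j : Isp → ℝ} (h : gtI Ssp i j) :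
    gtI S (fun ε => i (ρ ε)) (fun ε => j (ρ ε)) := by
  obtain ⟨e, he⟩ := EventuallyI.exists_forall_le hSsp h
  exact eventuallyI_comp_of_forall_le hρ he

theorem BigO.comp_infinitesimal {I : Type*} [Preorder I] {S : SetOfIndices I}
    {Ssp : SetOfIndices Isp} (hSsp : Ssp.sets = specialSets) {ρ : I → Isp}
    (hρ : limEq S (fun ε => (ρ ε : ℝ)) 0) {x y : Isp → ℝ} (h : BigO Ssp x y) :
    BigO S (fun ε => x (ρ ε)) (fun ε => y (ρ ε)) := by
  obtain ⟨A, hA, h⟩ := h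
  rw [hSsp] at hA
  obtain ⟨a, rfl⟩ := hA
  obtain ⟨H, hH, e, -, hea, he⟩ := h a (le_refl a)
  obtain ⟨A, hA, h⟩ := eventuallyI_comp_of_forall_le (P := fun t => |x t| ≤ H * |y t|) hρ
    fun t ht => he t (ht.trans hea) ht
  exact ⟨A, hA, fun a ha => ⟨H, hH, h a ha⟩⟩

theorem limInfinite.comp_infinitesimal {I : Type*} [Preorder I] {S : SetOfIndices I}
    {Ssp : SetOfIndices Isp} (hSsp : Ssp.sets = specialSets) {ρ : I → Isp}
    (hρ : limEq S (fun ε => (ρ ε : ℝ)) 0) {i : Isp → ℝ} (h : limInfinite Ssp i) :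
    limInfinite S (fun ε => i (ρ ε)) := by
  obtain ⟨A, hA, h⟩ := h
  rw [hSsp] at hA
  obtain ⟨a, rfl⟩ := hA
  obtain ⟨A, hA, hlim⟩ := hρ
  refine ⟨A, hA, fun b hb R hR => ?_⟩
  obtain ⟨e, hea, he⟩ := h a (le_refl a) R hR
  obtain ⟨b₀, hb₀, hρlt⟩ := hlim b hb e e.2.1
  refine ⟨b₀, hb₀, fun ε hε hle => ?_⟩
  have hlt := hρlt ε hε hle
  rw [zero_sub, abs_neg] at hlt
  have hρe : ρ ε ≤ e := Subtype.coe_le_coe.mp ((le_abs_self _).trans hlt.le)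
  exact he _ (hρe.trans hea) hρe

/-- composing an asymptotic gauge on `𝕀^s` with an infinitesimal
net `ρ` gives an asymptotic gauge on `𝕀` (Thm. `AGfromInfinitesRho` of the paper). -/
theorem AG_comp_rho {I : Type*} [Preorder I] (S : SetOfIndices I)
    (Ssp : SetOfIndices Isp) (hSsp : Ssp.sets = specialSets)
    (ρ : I → Isp) (hρ : limEq S (fun ε => (ρ ε : ℝ)) 0)
    (B : Set (Isp → ℝ)) (hB : IsAG Ssp B) :
    IsAG S {f | ∃ i ∈ B, f = fun ε => i (ρ ε)} ∧
    ((∀ i ∈ B, gtI Ssp i (fun _ => 0)) →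
      ∀ f ∈ {f | ∃ i ∈ B, f = fun ε => i (ρ ε)}, gtI S f (fun _ => 0)) ∧
    ((∀ i ∈ B, ∀ j ∈ B, BigO Ssp i j ∨ BigO Ssp j i) →
      ∀ f ∈ {f | ∃ i ∈ B, f = fun ε => i (ρ ε)},
        ∀ g ∈ {f | ∃ i ∈ B, f = fun ε => i (ρ ε)},
          BigO S f g ∨ BigO S g f) := by
  refine ⟨⟨?_, ?_, ?_, ?_⟩, ?_, ?_⟩
  · obtain ⟨i, hi, h⟩ := hB.infinite
    exact ⟨_, ⟨i, hi, rfl⟩, h.comp_infinitesimal hSsp hρ⟩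
  · rintro _ ⟨i, hi, rfl⟩ _ ⟨j, hj, rfl⟩
    obtain ⟨p, hp, h⟩ := hB.mul i hi j hj
    exact ⟨_, ⟨p, hp, rfl⟩, h.comp_infinitesimal hSsp hρ⟩
  · rintro _ ⟨i, hi, rfl⟩ r
    obtain ⟨σ, hσ, h⟩ := hB.smul i hi r
    exact ⟨_, ⟨σ, hσ, rfl⟩, h.comp_infinitesimal hSsp hρ⟩
  · rintro _ ⟨i, hi, rfl⟩ _ ⟨j, hj, rfl⟩
    obtain ⟨s, hs, hpos, h⟩ := hB.absAdd i hi j hj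
    exact ⟨_, ⟨s, hs, rfl⟩, hpos.comp_infinitesimal hSsp hρ, h.comp_infinitesimal hSsp hρ⟩
  · rintro hpos _ ⟨i, hi, rfl⟩
    exact (hpos i hi).comp_infinitesimal hSsp hρ
  · rintro htot _ ⟨i, hi, rfl⟩ _ ⟨j, hj, rfl⟩
    exact (htot i hi j hj).imp (·.comp_infinitesimal hSsp hρ) (·.comp_infinitesimal hSsp hρ)
end

section
/- Let 𝕀 = (I, ≤, 𝓘) be a set of indices, let 𝓑 and 𝒵 be asymptotic gauges on 𝕀, and let Ω ⊆ ℝⁿ be an open set. Then both ℰ_M(𝓑,Ω) and 𝒩(𝒵,Ω) are subrings of the ring of all nets of smooth functions (C^∞(Ω,ℝ))^I with pointwise operations: each contains the zero net, is closed under negation, and is closed under addition and multiplication of nets. -/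
open MeasureTheory

/-- A solid set of nets of real numbers that is closed under sums and products. -/
structure IsSolidRing {I : Type*} (M : Set (I → ℝ)) : Prop where
  zero : (fun _ => 0) ∈ M
  add : ∀ x ∈ M, ∀ y ∈ M, (fun ε => x ε + y ε) ∈ M
  mul : ∀ x ∈ M, ∀ y ∈ M, (fun ε => x ε * y ε) ∈ M
  solid : ∀ x, ∀ y ∈ M, (∀ ε, |x ε| ≤ |y ε|) → x ∈ M

section Asymptotics

variable {I : Type*} [Preorder I] {S : SetOfIndices I}

/-- `Q H ε` holds for `ε` sufficiently small, with a constant `H > 0` that may depend on the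
index `a` below which `ε` is taken. -/
def EventuallyWithConst (S : SetOfIndices I) (Q : ℝ → I → Prop) : Prop :=
  ∃ A ∈ S.sets, ∀ a ∈ A, ∃ H : ℝ, 0 < H ∧ ∃ ε₀, ε₀ ∈ A ∧ ε₀ ≤ a ∧ ∀ ε ∈ A, ε ≤ ε₀ → Q H ε

theorem EventuallyWithConst.mono₂ {P Q R : ℝ → I → Prop} (hP : EventuallyWithConst S P)
    (hQ : EventuallyWithConst S Q)
    (h : ∀ H₁ > 0, ∀ H₂ > 0, ∃ H > 0, ∀ ε, P H₁ ε → Q H₂ ε → R H ε) :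
    EventuallyWithConst S R := by
  obtain ⟨A, hA, hPA⟩ := hP
  obtain ⟨A', hA', hQA⟩ := hQ
  obtain ⟨C, hC, hCA⟩ := S.inter_sub A hA A' hA'
  refine ⟨C, hC, fun c hc => ?_⟩
  obtain ⟨H₁, hH₁, e₁, -, he₁c, hP'⟩ := hPA c (hCA hc).1
  obtain ⟨d₁, hd₁C, hd₁⟩ := (S.downward C hC c hc e₁ he₁c).1
  obtain ⟨H₂, hH₂, e₂, -, he₂, hQ'⟩ := hQA d₁ (hCA hd₁C).2
  obtain ⟨d₂, hd₂C, hd₂⟩ := (S.downward C hC d₁ hd₁C e₂ he₂).1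
  obtain ⟨H, hH, hR⟩ := h H₁ hH₁ H₂ hH₂
  refine ⟨H, hH, d₂, hd₂C, hd₂.trans (he₂.trans (hd₁.trans he₁c)), fun ε hε hεd => ?_⟩
  exact hR ε (hP' ε (hCA hε).1 (hεd.trans (hd₂.trans (he₂.trans hd₁))))
    (hQ' ε (hCA hε).2 (hεd.trans hd₂))

theorem EventuallyI.withConst {P : I → Prop} (h : EventuallyI S P) :
    EventuallyWithConst S (fun _ => P) := by
  obtain ⟨A, hA, h⟩ := h
  exact ⟨A, hA, fun a ha => ⟨1, one_pos, h a ha⟩⟩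

theorem limInfinite.eventually_lt {f : I → ℝ} (h : limInfinite S f) {R : ℝ} (hR : 0 < R) :
    EventuallyI S (fun ε => R < |f ε|) := by
  obtain ⟨A, hA, h⟩ := h
  refine ⟨A, hA, fun a ha => ?_⟩
  obtain ⟨a₀, ha₀, h₀⟩ := h a ha R hR
  obtain ⟨e, heA, he⟩ := (S.downward A hA a ha a₀ ha₀).1
  exact ⟨e, heA, he.trans ha₀, fun ε hε hεe => h₀ ε hε (hεe.trans he)⟩

theorem bigO_of_abs_le {x y : I → ℝ} (h : ∀ ε, |x ε| ≤ |y ε|) : BigO S x y :=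
  ⟨Set.univ, S.univ_mem, fun a ha => ⟨1, one_pos, a, ha, le_rfl, fun ε _ _ => by
    simpa using h ε⟩⟩

theorem BigO.add {x x' y y' : I → ℝ} (h : BigO S x y) (h' : BigO S x' y') :
    BigO S (fun ε => x ε + x' ε) (fun ε => |y ε| + |y' ε|) :=
  EventuallyWithConst.mono₂ h h' fun H₁ h₁ H₂ h₂ =>
    ⟨H₁ + H₂, add_pos h₁ h₂, fun ε hx hx' => by
      rw [abs_of_nonneg (add_nonneg (abs_nonneg (y ε)) (abs_nonneg (y' ε)))]
      nlinarith [abs_add_le (x ε) (x' ε), mul_nonneg h₁.le (abs_nonneg (y' ε)),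
        mul_nonneg h₂.le (abs_nonneg (y ε))]⟩

theorem BigO.mul {x x' y y' : I → ℝ} (h : BigO S x y) (h' : BigO S x' y') :
    BigO S (fun ε => x ε * x' ε) (fun ε => y ε * y' ε) :=
  EventuallyWithConst.mono₂ h h' fun H₁ h₁ H₂ h₂ =>
    ⟨H₁ * H₂, mul_pos h₁ h₂, fun ε hx hx' => by
      rw [abs_mul, abs_mul, mul_mul_mul_comm]
      exact mul_le_mul hx hx' (abs_nonneg _) (mul_nonneg h₁.le (abs_nonneg _))⟩

theorem BigO.add_same {x x' y : I → ℝ} (h : BigO S x y) (h' : BigO S x' y) :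
    BigO S (fun ε => x ε + x' ε) y :=
  EventuallyWithConst.mono₂ h h' fun H₁ h₁ H₂ h₂ =>
    ⟨H₁ + H₂, add_pos h₁ h₂, fun ε hx hx' => by
      rw [add_mul]
      exact (abs_add_le _ _).trans (add_le_add hx hx')⟩

/-- If `y = O(s)` and `y` is eventually nonzero then `s⁻¹ = O(y⁻¹)`. -/
theorem BigO.inv {y s : I → ℝ} (h : BigO S y s) (hy : EventuallyI S (fun ε => 0 < |y ε|)) :
    BigO S (fun ε => (s ε)⁻¹) (fun ε => (y ε)⁻¹) :=
  EventuallyWithConst.mono₂ h hy.withConst fun H hH _ _ =>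
    ⟨H, hH, fun ε hs hpos => by
      have hs0 : 0 < |s ε| := pos_of_mul_pos_right (hpos.trans_le hs) hH.le
      rw [abs_inv, abs_inv, ← div_eq_mul_inv, le_div_iff₀ hpos, inv_mul_le_iff₀ hs0, mul_comm]
      exact hs⟩

theorem IsAG.isSolidRing_RM {B : Set (I → ℝ)} (hB : IsAG S B) : IsSolidRing (RM S B) where
  zero := by
    obtain ⟨b, hb, -⟩ := hB.infinite
    exact ⟨b, hb, bigO_of_abs_le fun ε => by simp⟩
  add := by
    rintro x ⟨b, hb, hx⟩ y ⟨c, hc, hy⟩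
    obtain ⟨s, hs, -, h⟩ := hB.absAdd b hb c hc
    exact ⟨s, hs, (hx.add hy).trans h⟩
  mul := by
    rintro x ⟨b, hb, hx⟩ y ⟨c, hc, hy⟩
    obtain ⟨p, hp, h⟩ := hB.mul b hb c hc
    exact ⟨p, hp, (hx.mul hy).trans h⟩
  solid := by
    rintro x y ⟨b, hb, hy⟩ h
    exact ⟨b, hb, (bigO_of_abs_le h).trans hy⟩

/-- The `𝒵`-negligible nets of real numbers. -/
def negligibleNets (S : SetOfIndices I) (Z : Set (I → ℝ)) : Set (I → ℝ) :=
  {x | ∀ z ∈ agPos S Z, BigO S x (fun ε => (z ε)⁻¹)}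

theorem IsAG.isSolidRing_negligibleNets {Z : Set (I → ℝ)} (hZ : IsAG S Z) :
    IsSolidRing (negligibleNets S Z) where
  zero := fun z _ => bigO_of_abs_le fun ε => by simp
  add := fun x hx y hy z hz => (hx z hz).add_same (hy z hz)
  mul := by
    intro x hx y hy z hz
    obtain ⟨i, hi, hlim⟩ := hZ.infinite
    obtain ⟨s, hs, hpos, hO⟩ := hZ.absAdd i hi z hz.1
    have hone : BigO S (fun _ => 1) s := by
      refine BigO.trans (y := fun ε => |i ε| + |z ε|) ?_ hO
      refine EventuallyWithConst.mono₂ (hlim.eventually_lt one_pos).withConst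
        (hlim.eventually_lt one_pos).withConst fun _ _ _ _ => ⟨1, one_pos, fun ε h _ => ?_⟩
      rw [abs_one, one_mul, abs_of_nonneg (by positivity)]
      linarith [abs_nonneg (z ε)]
    have hzs : BigO S z s := by
      refine (bigO_of_abs_le fun ε => ?_).trans hO
      rw [abs_of_nonneg (by positivity : 0 ≤ |i ε| + |z ε|)]
      linarith [abs_nonneg (i ε)]
    have hs1 := hone.inv ⟨Set.univ, S.univ_mem, fun a ha => ⟨a, ha, le_rfl, by simp⟩⟩
    have hz0 : EventuallyI S (fun ε => 0 < |z ε|) := by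
      obtain ⟨A, hA, h⟩ := hz.2
      refine ⟨A, hA, fun a ha => ?_⟩
      obtain ⟨e, he, hea, h⟩ := h a ha
      exact ⟨e, he, hea, fun ε hε hεe => abs_pos.mpr (h ε hε hεe).ne'⟩
    have hmul := ((hx s ⟨hs, hpos⟩).trans hs1).mul ((hy s ⟨hs, hpos⟩).trans (hzs.inv hz0))
    simpa using hmul
  solid := fun x y hy h z hz => (bigO_of_abs_le h).trans (hy z hz)

end Asymptotics

section MultiDeriv

variable {n : ℕ} {Ω : Set (Fin n → ℝ)}

theorem ContDiffOn.pDeriv {f : (Fin n → ℝ) → ℝ} (hf : ContDiffOn ℝ (⊤ : ℕ∞) f Ω)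
    (hΩ : IsOpen Ω) (i : Fin n) : ContDiffOn ℝ (⊤ : ℕ∞) (pDeriv i f) Ω :=
  (hf.fderiv_of_isOpen hΩ (by simp)).clm_apply contDiffOn_const

theorem ContDiffOn.multiDeriv {f : (Fin n → ℝ) → ℝ} (hf : ContDiffOn ℝ (⊤ : ℕ∞) f Ω)
    (hΩ : IsOpen Ω) (l : List (Fin n)) : ContDiffOn ℝ (⊤ : ℕ∞) (multiDeriv l f) Ω := by
  induction l generalizing f with
  | nil => exact hf
  | cons i l ih => exact ih (hf.pDeriv hΩ i)

theorem Set.EqOn.pDeriv {f g : (Fin n → ℝ) → ℝ} (h : Set.EqOn f g Ω) (hΩ : IsOpen Ω)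
    (i : Fin n) : Set.EqOn (pDeriv i f) (pDeriv i g) Ω := fun x hx => by
  simp only [_root_.pDeriv, (h.eventuallyEq_of_mem (hΩ.mem_nhds hx)).fderiv_eq]

theorem Set.EqOn.multiDeriv {f g : (Fin n → ℝ) → ℝ} (h : Set.EqOn f g Ω) (hΩ : IsOpen Ω)
    (l : List (Fin n)) : Set.EqOn (multiDeriv l f) (multiDeriv l g) Ω := by
  induction l generalizing f g with
  | nil => exact h
  | cons i l ih => exact ih (h.pDeriv hΩ i)

theorem ContDiffOn.differentiableAt_of_isOpen {f : (Fin n → ℝ) → ℝ}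
    (hf : ContDiffOn ℝ (⊤ : ℕ∞) f Ω) (hΩ : IsOpen Ω) {x : Fin n → ℝ} (hx : x ∈ Ω) :
    DifferentiableAt ℝ f x :=
  (hf.contDiffAt (hΩ.mem_nhds hx)).differentiableAt (by simp)

theorem multiDeriv_zero (l : List (Fin n)) : multiDeriv l (fun _ => 0) = fun _ => 0 := by
  induction l with
  | nil => rfl
  | cons i l ih =>
    have h : pDeriv i (fun _ : Fin n → ℝ => (0 : ℝ)) = fun _ => 0 := by
      ext x
      simp [pDeriv]
    rw [multiDeriv, h, ih]

theorem multiDeriv_neg (l : List (Fin n)) (f : (Fin n → ℝ) → ℝ) :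
    multiDeriv l (fun x => -f x) = fun x => -multiDeriv l f x := by
  induction l generalizing f with
  | nil => rfl
  | cons i l ih =>
    have h : pDeriv i (fun x => -f x) = fun x => -pDeriv i f x := by
      ext x
      simp [pDeriv, fderiv_fun_neg]
    rw [multiDeriv, h, ih, multiDeriv]

theorem pDeriv_add_eqOn (hΩ : IsOpen Ω) {f g : (Fin n → ℝ) → ℝ}
    (hf : ContDiffOn ℝ (⊤ : ℕ∞) f Ω) (hg : ContDiffOn ℝ (⊤ : ℕ∞) g Ω) (i : Fin n) :
    Set.EqOn (pDeriv i (fun x => f x + g x)) (fun x => pDeriv i f x + pDeriv i g x) Ω :=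
  fun x hx => by
    simp [pDeriv, fderiv_fun_add (hf.differentiableAt_of_isOpen hΩ hx)
      (hg.differentiableAt_of_isOpen hΩ hx)]

theorem pDeriv_mul_eqOn (hΩ : IsOpen Ω) {f g : (Fin n → ℝ) → ℝ}
    (hf : ContDiffOn ℝ (⊤ : ℕ∞) f Ω) (hg : ContDiffOn ℝ (⊤ : ℕ∞) g Ω) (i : Fin n) :
    Set.EqOn (pDeriv i (fun x => f x * g x))
      (fun x => pDeriv i f x * g x + f x * pDeriv i g x) Ω :=
  fun x hx => by
    simp [pDeriv, fderiv_fun_mul (hf.differentiableAt_of_isOpen hΩ hx)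
      (hg.differentiableAt_of_isOpen hΩ hx)]
    ring

theorem multiDeriv_add_eqOn (hΩ : IsOpen Ω) (l : List (Fin n)) {f g : (Fin n → ℝ) → ℝ}
    (hf : ContDiffOn ℝ (⊤ : ℕ∞) f Ω) (hg : ContDiffOn ℝ (⊤ : ℕ∞) g Ω) :
    Set.EqOn (multiDeriv l (fun x => f x + g x))
      (fun x => multiDeriv l f x + multiDeriv l g x) Ω := by
  induction l generalizing f g with
  | nil => exact fun _ _ => rfl
  | cons i l ih =>
    exact ((pDeriv_add_eqOn hΩ hf hg i).multiDeriv hΩ l).trans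
      (ih (hf.pDeriv hΩ i) (hg.pDeriv hΩ i))

end MultiDeriv

section SupAbsOn

variable {X : Type*} {K : Set X}

theorem supAbsOn_nonneg (K : Set X) (f : X → ℝ) : 0 ≤ supAbsOn K f :=
  Real.sSup_nonneg (by rintro _ ⟨x, -, rfl⟩; exact abs_nonneg _)

theorem supAbsOn_le {f : X → ℝ} {c : ℝ} (hc : 0 ≤ c) (h : ∀ x ∈ K, |f x| ≤ c) :
    supAbsOn K f ≤ c :=
  Real.sSup_le (by rintro _ ⟨x, hx, rfl⟩; exact h x hx) hc

theorem supAbsOn_congr {f g : X → ℝ} (h : Set.EqOn f g K) : supAbsOn K f = supAbsOn K g := by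
  unfold supAbsOn
  rw [Set.image_congr fun x hx => by rw [h hx]]

theorem abs_le_supAbsOn [TopologicalSpace X] (hK : IsCompact K) {f : X → ℝ}
    (hf : ContinuousOn f K) {x : X} (hx : x ∈ K) : |f x| ≤ supAbsOn K f :=
  le_csSup (hK.bddAbove_image hf.abs) ⟨x, hx, rfl⟩

theorem supAbsOn_add_le [TopologicalSpace X] (hK : IsCompact K) {f g : X → ℝ}
    (hf : ContinuousOn f K) (hg : ContinuousOn g K) :
    supAbsOn K (fun x => f x + g x) ≤ supAbsOn K f + supAbsOn K g :=
  supAbsOn_le (add_nonneg (supAbsOn_nonneg K f) (supAbsOn_nonneg K g)) fun _ hx =>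
    (abs_add_le _ _).trans (add_le_add (abs_le_supAbsOn hK hf hx) (abs_le_supAbsOn hK hg hx))

theorem supAbsOn_mul_le [TopologicalSpace X] (hK : IsCompact K) {f g : X → ℝ}
    (hf : ContinuousOn f K) (hg : ContinuousOn g K) :
    supAbsOn K (fun x => f x * g x) ≤ supAbsOn K f * supAbsOn K g :=
  supAbsOn_le (mul_nonneg (supAbsOn_nonneg K f) (supAbsOn_nonneg K g)) fun x hx => by
    rw [abs_mul]
    exact mul_le_mul (abs_le_supAbsOn hK hf hx) (abs_le_supAbsOn hK hg hx) (abs_nonneg _)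
      (supAbsOn_nonneg K f)

end SupAbsOn

section SmoothNets

variable {I : Type*} {n : ℕ} {M : Set (I → ℝ)} {Ω : Set (Fin n → ℝ)}
  {u v : I → (Fin n → ℝ) → ℝ}

/-- All derivatives of `u` have suprema over compact subsets of `Ω` that belong to `M`. -/
def DerivSupsMem (M : Set (I → ℝ)) (Ω : Set (Fin n → ℝ)) (u : I → (Fin n → ℝ) → ℝ) : Prop :=
  ∀ K : Set (Fin n → ℝ), K ⊆ Ω → IsCompact K → ∀ l : List (Fin n),
    (fun ε => supAbsOn K (multiDeriv l (u ε))) ∈ M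

theorem DerivSupsMem.pDeriv (hu : DerivSupsMem M Ω u) (i : Fin n) :
    DerivSupsMem M Ω (fun ε => pDeriv i (u ε)) :=
  fun K hK hKc l => hu K hK hKc (i :: l)

theorem DerivSupsMem.zero (hM : IsSolidRing M) :
    DerivSupsMem M Ω (fun _ _ => 0) := fun K _ _ l => by
  refine hM.solid _ _ hM.zero fun ε => ?_
  rw [multiDeriv_zero, abs_of_nonneg (supAbsOn_nonneg _ _), abs_zero]
  exact supAbsOn_le le_rfl fun _ _ => by simp

theorem DerivSupsMem.neg (hu : DerivSupsMem M Ω u) :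
    DerivSupsMem M Ω (fun ε x => -u ε x) := fun K hK hKc l => by
  simpa only [multiDeriv_neg, supAbsOn, abs_neg] using hu K hK hKc l

theorem DerivSupsMem.add (hM : IsSolidRing M) (hΩ : IsOpen Ω)
    (hus : ∀ ε, ContDiffOn ℝ (⊤ : ℕ∞) (u ε) Ω) (hvs : ∀ ε, ContDiffOn ℝ (⊤ : ℕ∞) (v ε) Ω)
    (hu : DerivSupsMem M Ω u) (hv : DerivSupsMem M Ω v) :
    DerivSupsMem M Ω (fun ε x => u ε x + v ε x) := fun K hK hKc l => by
  refine hM.solid _ _ (hM.add _ (hu K hK hKc l) _ (hv K hK hKc l)) fun ε => ?_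
  rw [supAbsOn_congr ((multiDeriv_add_eqOn hΩ l (hus ε) (hvs ε)).mono hK)]
  exact abs_le_abs_of_nonneg (supAbsOn_nonneg _ _) (supAbsOn_add_le hKc
    (((hus ε).multiDeriv hΩ l).continuousOn.mono hK)
    (((hvs ε).multiDeriv hΩ l).continuousOn.mono hK))

theorem DerivSupsMem.mul (hM : IsSolidRing M) (hΩ : IsOpen Ω)
    (hus : ∀ ε, ContDiffOn ℝ (⊤ : ℕ∞) (u ε) Ω) (hvs : ∀ ε, ContDiffOn ℝ (⊤ : ℕ∞) (v ε) Ω)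
    (hu : DerivSupsMem M Ω u) (hv : DerivSupsMem M Ω v) :
    DerivSupsMem M Ω (fun ε x => u ε x * v ε x) := fun K hK hKc l => by
  induction l generalizing u v with
  | nil =>
    refine hM.solid _ _ (hM.mul _ (hu K hK hKc []) _ (hv K hK hKc [])) fun ε => ?_
    exact abs_le_abs_of_nonneg (supAbsOn_nonneg _ _) (supAbsOn_mul_le hKc
      ((hus ε).continuousOn.mono hK) ((hvs ε).continuousOn.mono hK))
  | cons i l ih =>
    have hus' := fun ε => (hus ε).pDeriv hΩ i
    have hvs' := fun ε => (hvs ε).pDeriv hΩ i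
    refine hM.solid _ _ (hM.add _ (ih hus' hvs (hu.pDeriv i) hv) _
      (ih hus hvs' hu (hv.pDeriv i))) fun ε => ?_
    have h₁ := (hus' ε).mul (hvs ε)
    have h₂ := (hus ε).mul (hvs' ε)
    rw [multiDeriv, supAbsOn_congr ((((pDeriv_mul_eqOn hΩ (hus ε) (hvs ε) i).multiDeriv hΩ l).trans
      (multiDeriv_add_eqOn hΩ l h₁ h₂)).mono hK)]
    exact abs_le_abs_of_nonneg (supAbsOn_nonneg _ _) (supAbsOn_add_le hKc
      ((h₁.multiDeriv hΩ l).continuousOn.mono hK) ((h₂.multiDeriv hΩ l).continuousOn.mono hK))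

end SmoothNets

/-- `ℰ_M(𝓑,Ω)` and `𝒩(𝒵,Ω)` are subrings of `(C^∞(Ω,ℝ))^I`
(Lem. `moderateNegligibleRings` of the paper). -/
theorem moderate_negligible_rings {I : Type*} [Preorder I] (S : SetOfIndices I)
    {n : ℕ} (B Z : Set (I → ℝ)) (hB : IsAG S B) (hZ : IsAG S Z)
    (Ω : Set (Fin n → ℝ)) (hΩ : IsOpen Ω) :
    -- `ℰ_M(𝓑,Ω)` is a subring:
    (EMod S B Ω (fun _ _ => (0 : ℝ))) ∧
    (∀ u : I → (Fin n → ℝ) → ℝ, (∀ ε, ContDiffOn ℝ (⊤ : ℕ∞) (u ε) Ω) →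
      EMod S B Ω u → EMod S B Ω (fun ε x => -(u ε x))) ∧
    (∀ u v : I → (Fin n → ℝ) → ℝ, (∀ ε, ContDiffOn ℝ (⊤ : ℕ∞) (u ε) Ω) →
      (∀ ε, ContDiffOn ℝ (⊤ : ℕ∞) (v ε) Ω) → EMod S B Ω u → EMod S B Ω v →
      EMod S B Ω (fun ε x => u ε x + v ε x) ∧
      EMod S B Ω (fun ε x => u ε x * v ε x)) ∧
    -- `𝒩(𝒵,Ω)` is a subring:
    (NNeg S Z Ω (fun _ _ => (0 : ℝ))) ∧
    (∀ u : I → (Fin n → ℝ) → ℝ, (∀ ε, ContDiffOn ℝ (⊤ : ℕ∞) (u ε) Ω) →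
      NNeg S Z Ω u → NNeg S Z Ω (fun ε x => -(u ε x))) ∧
    (∀ u v : I → (Fin n → ℝ) → ℝ, (∀ ε, ContDiffOn ℝ (⊤ : ℕ∞) (u ε) Ω) →
      (∀ ε, ContDiffOn ℝ (⊤ : ℕ∞) (v ε) Ω) → NNeg S Z Ω u → NNeg S Z Ω v →
      NNeg S Z Ω (fun ε x => u ε x + v ε x) ∧
      NNeg S Z Ω (fun ε x => u ε x * v ε x)) := by
  have hE := hB.isSolidRing_RM
  have hN := hZ.isSolidRing_negligibleNets
  have hNNeg : ∀ w, NNeg S Z Ω w ↔ DerivSupsMem (negligibleNets S Z) Ω w := fun _ => Iff.rfl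
  have hEMod : ∀ w, EMod S B Ω w ↔ DerivSupsMem (RM S B) Ω w := fun _ => Iff.rfl
  simp only [hNNeg, hEMod]
  exact ⟨.zero hE, fun u _ hu => hu.neg,
    fun u v hus hvs hu hv => ⟨.add hE hΩ hus hvs hu hv, .mul hE hΩ hus hvs hu hv⟩,
    .zero hN, fun u _ hu => hu.neg,
    fun u v hus hvs hu hv => ⟨.add hN hΩ hus hvs hu hv, .mul hN hΩ hus hvs hu hv⟩⟩
end

section
/- Let 𝕀 = (I, ≤, 𝓘) be a set of indices and let 𝓑, 𝒵 be asymptotic gauges on 𝕀. Then the following are equivalent: (i) ℝ_M(𝓑) ⊆ ℝ_M(𝒵); (ii) for every b ∈ 𝓑 and every z ∈ 𝒵_{>0} there exists w ∈ 𝒵_{>0} such that (w_ε^{-1}·b_ε)_ε = O((z_ε^{-1})_ε). -/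
open MeasureTheory

section LocallyEventually

variable {I α β : Type*} [Preorder I] {S : SetOfIndices I}

/-- `P h ε` holds for `ε` sufficiently small, where the parameter `h` may depend on the
base point below which the indices are taken. -/
def LocallyEventually (S : SetOfIndices I) (P : α → I → Prop) : Prop :=
  ∃ A ∈ S.sets, ∀ a ∈ A, ∃ h, ∃ e ∈ A, e ≤ a ∧ ∀ ε ∈ A, ε ≤ e → P h ε

theorem LocallyEventually.and {P : α → I → Prop} {Q : β → I → Prop}
    (hP : LocallyEventually S P) (hQ : LocallyEventually S Q) :
    LocallyEventually S (fun (h : α × β) ε => P h.1 ε ∧ Q h.2 ε) := by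
  obtain ⟨A, hA, hP⟩ := hP
  obtain ⟨B, hB, hQ⟩ := hQ
  obtain ⟨C, hC, hCAB⟩ := S.inter_sub A hA B hB
  refine ⟨C, hC, fun a ha => ?_⟩
  obtain ⟨h, e, -, hea, he⟩ := hP a (hCAB ha).1
  obtain ⟨c, hc, hce⟩ := (S.downward C hC a ha e hea).1
  obtain ⟨k, f, -, hfc, hf⟩ := hQ c (hCAB hc).2
  obtain ⟨d, hd, hdf⟩ := (S.downward C hC c hc f hfc).1
  exact ⟨(h, k), d, hd, hdf.trans (hfc.trans (hce.trans hea)), fun ε hε hεd =>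
    ⟨he ε (hCAB hε).1 (hεd.trans (hdf.trans (hfc.trans hce))),
      hf ε (hCAB hε).2 (hεd.trans hdf)⟩⟩

theorem LocallyEventually.mono {P : α → I → Prop} {Q : β → I → Prop}
    (hP : LocallyEventually S P) (g : α → β) (hPQ : ∀ h ε, P h ε → Q (g h) ε) :
    LocallyEventually S Q := by
  obtain ⟨A, hA, hP⟩ := hP
  refine ⟨A, hA, fun a ha => ?_⟩
  obtain ⟨h, e, heA, hea, he⟩ := hP a ha
  exact ⟨g h, e, heA, hea, fun ε hε hεe => hPQ h ε (he ε hε hεe)⟩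

theorem bigO_iff_locallyEventually {x y : I → ℝ} :
    BigO S x y ↔ LocallyEventually S (fun (H : ℝ) ε => 0 < H ∧ |x ε| ≤ H * |y ε|) := by
  constructor
  · rintro ⟨A, hA, h⟩
    refine ⟨A, hA, fun a ha => ?_⟩
    obtain ⟨H, hH, e, heA, hea, he⟩ := h a ha
    exact ⟨H, e, heA, hea, fun ε hε hεe => ⟨hH, he ε hε hεe⟩⟩
  · rintro ⟨A, hA, h⟩
    refine ⟨A, hA, fun a ha => ?_⟩
    obtain ⟨H, e, heA, hea, he⟩ := h a ha
    exact ⟨H, (he e heA le_rfl).1, e, heA, hea, fun ε hε hεe => (he ε hε hεe).2⟩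

theorem gtI.locallyEventually {i j : I → ℝ} (h : gtI S i j) :
    LocallyEventually S (fun (_ : Unit) ε => j ε < i ε) := by
  obtain ⟨A, hA, h⟩ := h
  exact ⟨A, hA, fun a ha => ⟨(), h a ha⟩⟩

theorem limInfinite.locallyEventually {f : I → ℝ} (h : limInfinite S f) {R : ℝ} (hR : 0 < R) :
    LocallyEventually S (fun (_ : Unit) ε => R < |f ε|) := by
  obtain ⟨A, hA, h⟩ := h
  refine ⟨A, hA, fun a ha => ?_⟩
  obtain ⟨a₀, ha₀, hlt⟩ := h a ha R hR
  obtain ⟨e, he, hea₀⟩ := (S.downward A hA a ha a₀ ha₀).1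
  exact ⟨(), e, he, hea₀.trans ha₀, fun ε hε hεe => hlt ε hε (hεe.trans hea₀)⟩

theorem bigO_refl (S : SetOfIndices I) (x : I → ℝ) : BigO S x x :=
  ⟨Set.univ, S.univ_mem, fun a ha => ⟨1, one_pos, a, ha, le_rfl, fun _ _ _ => by simp⟩⟩

/-- Every net of an asymptotic gauge is dominated by a positive one. -/
theorem IsAG.exists_pos_bigO {B : Set (I → ℝ)} (hB : IsAG S B) {i : I → ℝ} (hi : i ∈ B) :
    ∃ s ∈ agPos S B, BigO S i s := by
  obtain ⟨s, hs, hpos, hO⟩ := hB.absAdd i hi i hi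
  refine ⟨s, ⟨hs, hpos⟩, bigO_iff_locallyEventually.2
    ((bigO_iff_locallyEventually.1 hO).mono id fun H ε h => ⟨h.1, le_trans ?_ h.2⟩)⟩
  rw [abs_of_nonneg (add_nonneg (abs_nonneg (i ε)) (abs_nonneg (i ε)))]
  linarith [abs_nonneg (i ε)]

/-- An asymptotic gauge contains a positive net whose reciprocal is bounded. -/
theorem IsAG.exists_pos_inv_bigO_one {B : Set (I → ℝ)} (hB : IsAG S B) :
    ∃ s ∈ agPos S B, BigO S (fun ε => (s ε)⁻¹) (fun _ => 1) := by
  obtain ⟨i, hi, hlim⟩ := hB.infinite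
  obtain ⟨s, hs, hO⟩ := hB.exists_pos_bigO hi
  refine ⟨s, hs, bigO_iff_locallyEventually.2
    (((bigO_iff_locallyEventually.1 hO).and ((hlim.locallyEventually one_pos).and
      hs.2.locallyEventually)).mono Prod.fst ?_)⟩
  rintro ⟨H, _⟩ ε ⟨⟨hH, his⟩, hi1, hpos⟩
  refine ⟨hH, ?_⟩
  simp only [abs_inv, abs_one, mul_one]
  rw [inv_le_iff_one_le_mul₀ (abs_pos.2 hpos.ne')]
  exact hi1.le.trans his

end LocallyEventually

/-- characterization of `ℝ_M(𝓑) ⊆ ℝ_M(𝒵)` in terms of representatives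
(Thm. `equivCondForIdeal`, (i) ⇔ (ii), of the paper). -/
theorem RM_subset_iff {I : Type*} [Preorder I] (S : SetOfIndices I)
    (B Z : Set (I → ℝ)) (hB : IsAG S B) (hZ : IsAG S Z) :
    RM S B ⊆ RM S Z ↔
      ∀ b ∈ B, ∀ z ∈ agPos S Z, ∃ w ∈ agPos S Z,
        BigO S (fun ε => (w ε)⁻¹ * b ε) (fun ε => (z ε)⁻¹) := by
  constructor
  · intro hsub b hb z hz
    obtain ⟨y, hy, hby⟩ := hsub ⟨b, hb, bigO_refl S b⟩
    obtain ⟨p, hp, hyz⟩ := hZ.mul y hy z hz.1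
    obtain ⟨w, hw, hpw⟩ := hZ.exists_pos_bigO hp
    rw [bigO_iff_locallyEventually] at hby hyz hpw
    refine ⟨w, hw, bigO_iff_locallyEventually.2
      ((hby.and (hyz.and (hpw.and (hw.2.locallyEventually.and hz.2.locallyEventually)))).mono
        (fun h => h.1 * h.2.1 * h.2.2.1) ?_)⟩
    rintro ⟨H, K, L, _⟩ ε ⟨⟨hH, hby⟩, ⟨hK, hyz⟩, ⟨hL, hpw⟩, hwpos, hzpos⟩
    dsimp only at *
    refine ⟨by positivity, ?_⟩
    rw [abs_mul, abs_inv, abs_inv, abs_of_pos hzpos, abs_of_pos hwpos, inv_mul_eq_div,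
      ← div_eq_mul_inv, div_le_div_iff₀ hwpos hzpos]
    rw [abs_mul, abs_of_pos hzpos] at hyz
    rw [abs_of_pos hwpos] at hpw
    calc |b ε| * z ε ≤ H * |y ε| * z ε := by gcongr
      _ = H * (|y ε| * z ε) := by ring
      _ ≤ H * (K * |p ε|) := mul_le_mul_of_nonneg_left hyz hH.le
      _ ≤ H * (K * (L * w ε)) := by gcongr
      _ = H * K * L * w ε := by ring
  · rintro h x ⟨b, hb, hxb⟩
    obtain ⟨z, hz, hz1⟩ := hZ.exists_pos_inv_bigO_one
    obtain ⟨w, hw, hwb⟩ := h b hb z hz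
    rw [bigO_iff_locallyEventually] at hxb hz1 hwb
    refine ⟨w, hw.1, bigO_iff_locallyEventually.2
      ((hxb.and (hwb.and (hz1.and hw.2.locallyEventually))).mono
        (fun h => h.1 * h.2.1 * h.2.2.1) ?_)⟩
    rintro ⟨H, K, L, _⟩ ε ⟨⟨hH, hxb⟩, ⟨hK, hwb⟩, ⟨hL, hz1⟩, hwpos⟩
    dsimp only at *
    refine ⟨by positivity, ?_⟩
    rw [abs_one, mul_one] at hz1
    rw [abs_mul, abs_inv, inv_mul_eq_div, div_le_iff₀ (abs_pos.2 hwpos.ne')] at hwb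
    calc |x ε| ≤ H * |b ε| := hxb
      _ ≤ H * (K * L * |w ε|) := by gcongr; exact hwb.trans (by gcongr)
      _ = H * K * L * |w ε| := by ring
end

section
/- Let 𝕀 = (I, ≤, 𝓘) be a set of indices, let b : I → ℝ with b_ε > 0 for all ε ∈ I and lim_𝕀 b = +∞, and let ρ be a Schwartz function on ℝⁿ with ∫_{ℝⁿ} ρ(x) dx = 1. Define ρ_ε(x) := b_ε^n · ρ(b_ε x). Then for every smooth compactly supported function φ : ℝⁿ → ℝ, the net of real numbers (∫_{ℝⁿ} ρ_ε(x)·φ(x) dx)_{ε∈I} has limit φ(0) in 𝕀, i.e. lim_𝕀 (∫ ρ_ε φ) = φ(0). -/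
open MeasureTheory

open Filter Topology in
/-- Dilations of an integrable kernel, tested against a bounded continuous function, converge to
the value at `0` times the total mass of the kernel. -/
theorem tendsto_integral_dilation_mul {n : ℕ} {ρ φ : (Fin n → ℝ) → ℝ} (hρ : Integrable ρ)
    (hφ : Continuous φ) {C : ℝ} (hC : ∀ x, ‖φ x‖ ≤ C) :
    Tendsto (fun c : ℝ => ∫ x, c ^ n * ρ (c • x) * φ x) atTop (𝓝 ((∫ x, ρ x) * φ 0)) := by
  have rescale : ∀ c : ℝ, 0 < c →
      ∫ x, ρ x * φ (c⁻¹ • x) = ∫ x, c ^ n * ρ (c • x) * φ x := by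
    intro c hc
    have key := Measure.integral_comp_smul volume (fun x => ρ x * φ (c⁻¹ • x)) c
    simp only [inv_smul_smul₀ hc.ne', Module.finrank_fin_fun, smul_eq_mul] at key
    rw [abs_of_pos (by positivity)] at key
    simp only [mul_assoc, integral_const_mul]
    rw [key, mul_inv_cancel_left₀ (by positivity)]
  rw [← integral_mul_const]
  refine Tendsto.congr' ((eventually_gt_atTop 0).mono rescale) ?_
  refine tendsto_integral_filter_of_dominated_convergence (fun x => ‖ρ x‖ * C)
    (.of_forall fun c => hρ.aestronglyMeasurable.mul
      (hφ.comp (continuous_const_smul c⁻¹)).aestronglyMeasurable)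
    (.of_forall fun c => .of_forall fun x => ?_) (hρ.norm.mul_const C)
    (.of_forall fun x => ?_)
  · rw [norm_mul]
    gcongr
    exact hC _
  · have h : Tendsto (fun c : ℝ => c⁻¹ • x) atTop (𝓝 0) := by
      simpa using (tendsto_inv_atTop_zero (𝕜 := ℝ)).smul_const x
    exact ((hφ.tendsto 0).comp h).const_mul (ρ x)

/-- Composing a net tending to `+∞` with a function having a limit at `+∞`. -/
theorem limPInf.limEq_comp {I : Type*} [Preorder I] {S : SetOfIndices I} {b : I → ℝ}
    (hb : limPInf S b) {f : ℝ → ℝ} {l : ℝ} (hf : Filter.Tendsto f Filter.atTop (nhds l)) :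
    limEq S (fun ε => f (b ε)) l := by
  obtain ⟨A, hA, h⟩ := hb
  refine ⟨A, hA, fun a ha r hr => ?_⟩
  obtain ⟨R, hR⟩ := Metric.tendsto_atTop.1 hf r hr
  obtain ⟨a₀, ha₀, h'⟩ := h a ha (max R 1) (by positivity)
  refine ⟨a₀, ha₀, fun ε hε hle => ?_⟩
  rw [← Real.dist_eq, dist_comm]
  exact hR _ ((le_max_left R 1).trans (h' ε hε hle).le)

/-- the mollified net converges to the point value:
`lim_𝕀 ∫ ρ_ε φ = φ(0)` (Lem. `convAndLimInD'` of the paper). -/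
theorem mollifier_limit {I : Type*} [Preorder I] (S : SetOfIndices I) {n : ℕ}
    (b : I → ℝ) (hbpos : ∀ ε, 0 < b ε) (hb : limPInf S b)
    (ρ : SchwartzMap (Fin n → ℝ) ℝ) (hρ : ∫ x, ρ x = 1)
    (φ : (Fin n → ℝ) → ℝ) (hφ : ContDiff ℝ (⊤ : ℕ∞) φ) (hφc : HasCompactSupport φ) :
    limEq S (fun ε => ∫ x, (b ε) ^ n * ρ (b ε • x) * φ x) (φ 0) := by
  obtain ⟨C, hC⟩ := hφc.exists_bound_of_continuous hφ.continuous
  have key := tendsto_integral_dilation_mul ρ.integrable hφ.continuous hC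
  rw [hρ, one_mul] at key
  exact hb.limEq_comp key
end

section
/- Let 𝕀 = (I, ≤, 𝓘) be a set of indices, let b : I → ℝ with b_ε > 0 for all ε ∈ I and lim_𝕀 b = +∞, and let ρ be a Schwartz function on ℝⁿ with ∫_{ℝⁿ} ρ(x) dx = 1 and ∫_{ℝⁿ} x^α ρ(x) dx = 0 for every multi-index α with |α| ≥ 1. Define ρ_ε(x) := b_ε^n · ρ(b_ε x). Then for every smooth compactly supported function f : ℝⁿ → ℝ, the net (f ∗ ρ_ε − f)_{ε∈I} is negligible with respect to the powers of b: for every compact K ⊆ ℝⁿ, every multi-index α ∈ ℕⁿ and every m ∈ ℕ, the net (sup_{x∈K} |∂^α(f ∗ ρ_ε)(x) − ∂^α f(x)|)_ε = O((b_ε^{−m})_ε), where (f ∗ ρ_ε)(x) := ∫_{ℝⁿ} f(x − y) ρ_ε(y) dy. -/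
open MeasureTheory

/-- The iterated derivative of `s ↦ g (x + s • v)` is the iterated Fréchet derivative of `g`
evaluated on the diagonal at `v`. -/
lemma iteratedDeriv_comp_add_smul {E F : Type*} [NormedAddCommGroup E] [NormedSpace ℝ E]
    [NormedAddCommGroup F] [NormedSpace ℝ F] {g : E → F} (hg : ContDiff ℝ (⊤ : ℕ∞) g)
    (x v : E) (k : ℕ) (s : ℝ) :
    iteratedDeriv k (fun s : ℝ => g (x + s • v)) s =
      iteratedFDeriv ℝ k g (x + s • v) (fun _ => v) := by
  have hg' : ContDiff ℝ (⊤ : ℕ∞) (fun z => g (x + z)) := by fun_prop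
  have h := (ContinuousLinearMap.toSpanSingleton ℝ v).iteratedFDeriv_comp_right hg' s
    (i := k) (by exact_mod_cast le_top)
  have hcomp : (fun z => g (x + z)) ∘ (ContinuousLinearMap.toSpanSingleton ℝ v)
      = fun s : ℝ => g (x + s • v) := by
    ext s; simp
  rw [hcomp] at h
  rw [iteratedDeriv_eq_iteratedFDeriv, h, iteratedFDeriv_comp_add_left]
  simp

/-- Taylor's formula with a remainder bound for functions on a normed space. -/
lemma norm_sub_taylor_le {E F : Type*} [NormedAddCommGroup E] [NormedSpace ℝ E]
    [NormedAddCommGroup F] [NormedSpace ℝ F] {g : E → F} (hg : ContDiff ℝ (⊤ : ℕ∞) g)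
    {C : ℝ} {m : ℕ} (hC : ∀ y, ‖iteratedFDeriv ℝ (m + 1) g y‖ ≤ C) (x v : E) :
    ‖g (x + v) - ∑ k ∈ Finset.range (m + 1),
      ((k.factorial : ℝ)⁻¹) • iteratedFDeriv ℝ k g x (fun _ => v)‖ ≤ C * ‖v‖ ^ (m + 1) := by
  set h : ℝ → F := fun s => g (x + s • v) with hh
  have hsmooth : ContDiff ℝ (⊤ : ℕ∞) h := by fun_prop
  have hsmooth' (k : ℕ) : ContDiff ℝ k h := hsmooth.of_le (by exact_mod_cast le_top)
  have hwithin (k : ℕ) {s : ℝ} (hs : s ∈ Set.Icc (0 : ℝ) 1) :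
      iteratedDerivWithin k h (Set.Icc 0 1) s =
        iteratedFDeriv ℝ k g (x + s • v) (fun _ => v) := by
    rw [iteratedDerivWithin_eq_iteratedDeriv (uniqueDiffOn_Icc one_pos)
      (hsmooth' k).contDiffAt hs, hh, iteratedDeriv_comp_add_smul hg]
  have hbound := taylor_mean_remainder_bound (f := h) (a := 0) (b := 1) (x := 1) (n := m)
    (C := C * ‖v‖ ^ (m + 1)) zero_le_one (by exact_mod_cast (hsmooth' (m + 1)).contDiffOn)
    (by simp) (fun y hy => by
      rw [hwithin (m + 1) hy]
      refine (ContinuousMultilinearMap.le_opNorm _ _).trans ?_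
      simp only [Finset.prod_const, Finset.card_univ, Fintype.card_fin]
      gcongr
      exact hC _)
  have hC0 : 0 ≤ C := (norm_nonneg _).trans (hC x)
  rw [taylor_within_apply] at hbound
  have hsum : ∑ k ∈ Finset.range (m + 1),
      (((k.factorial : ℝ)⁻¹ * (1 - 0) ^ k) • iteratedDerivWithin k h (Set.Icc 0 1) 0) =
      ∑ k ∈ Finset.range (m + 1),
        ((k.factorial : ℝ)⁻¹) • iteratedFDeriv ℝ k g x (fun _ => v) := by
    refine Finset.sum_congr rfl fun k _ => ?_
    rw [hwithin k (by simp)]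
    simp
  rw [hsum] at hbound
  have h1 : h 1 = g (x + v) := by simp [hh]
  rw [h1] at hbound
  refine hbound.trans ?_
  simp only [sub_zero, one_pow, mul_one]
  refine div_le_self (by positivity) ?_
  exact_mod_cast Nat.one_le_iff_ne_zero.mpr (Nat.factorial_ne_zero m)

/-- A continuous multilinear form on the diagonal is integrable against a Schwartz function. -/
lemma integrable_multilinear_diag_mul_schwartz {n k : ℕ} (ρ : SchwartzMap (Fin n → ℝ) ℝ)
    (M : ContinuousMultilinearMap ℝ (fun _ : Fin k => (Fin n → ℝ)) ℝ) :
    Integrable (fun u => M (fun _ => u) * ρ u) := by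
  refine ((ρ.integrable_pow_mul volume k).const_mul ‖M‖).mono'
    (by have := ρ.continuous; fun_prop) (Filter.Eventually.of_forall fun u => ?_)
  rw [norm_mul, ← mul_assoc]
  gcongr
  simpa using M.le_opNorm (fun _ => u)

/-- If all moments of positive order of `ρ` vanish, then so does the integral against `ρ` of any
homogeneous polynomial of positive degree. -/
lemma integral_multilinear_diag_mul_schwartz_eq_zero {n k : ℕ} (hk : 1 ≤ k)
    (ρ : SchwartzMap (Fin n → ℝ) ℝ)
    (hρmom : ∀ α : Fin n → ℕ, 1 ≤ ∑ i, α i → ∫ x, (∏ i, (x i) ^ (α i)) * ρ x = 0)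
    (M : ContinuousMultilinearMap ℝ (fun _ : Fin k => (Fin n → ℝ)) ℝ) :
    ∫ u, M (fun _ => u) * ρ u = 0 := by
  let count (r : Fin k → Fin n) (i : Fin n) : ℕ := (Finset.univ.filter fun j => r j = i).card
  have hcount (r : Fin k → Fin n) : ∑ i, count r i = k := by
    simpa [count] using
      (Finset.card_eq_sum_card_fiberwise (s := (Finset.univ : Finset (Fin k)))
        (t := Finset.univ) (f := r) (by simp)).symm
  have hprod (r : Fin k → Fin n) (u : Fin n → ℝ) : ∏ j, u (r j) = ∏ i, u i ^ count r i := by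
    rw [← Finset.prod_fiberwise_of_maps_to (g := r) (t := Finset.univ) (by simp)]
    refine Finset.prod_congr rfl fun i _ => ?_
    rw [Finset.prod_congr rfl (g := fun _ => u i) (fun j hj => by simp_all), Finset.prod_const]
  have hexp (u : Fin n → ℝ) : M (fun _ => u) * ρ u = ∑ r : Fin k → Fin n,
      M (fun j => Pi.single (r j) 1) * ((∏ i, u i ^ count r i) * ρ u) := by
    have hu : u = ∑ i, u i • (Pi.single i (1 : ℝ) : Fin n → ℝ) := by
      simpa using pi_eq_sum_univ' u
    conv_lhs => rw [hu]
    rw [M.map_sum, Finset.sum_mul, ← hu]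
    refine Finset.sum_congr rfl fun r _ => ?_
    rw [M.map_smul_univ (fun j => u (r j)), hprod, smul_eq_mul]
    ring
  have hint (r : Fin k → Fin n) : Integrable (fun u => (∏ i, u i ^ count r i) * ρ u) := by
    refine (integrable_multilinear_diag_mul_schwartz ρ
      ((ContinuousMultilinearMap.mkPiAlgebra ℝ (Fin k) ℝ).compContinuousLinearMap
        fun j => ContinuousLinearMap.proj (r j))).congr (Filter.Eventually.of_forall fun u => ?_)
    simp [hprod]
  simp_rw [hexp]
  rw [integral_finsetSum _ fun r _ => (hint r).const_mul _]
  refine Finset.sum_eq_zero fun r _ => ?_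
  rw [integral_const_mul, hρmom _ (by rw [hcount]; exact hk), mul_zero]

/-- Smoothing by a mollifier of width `c` whose moments of positive order all vanish
approximates a smooth function with bounded derivatives to order `c ^ (m + 1)`. -/
lemma abs_integral_scaled_sub_le {n m : ℕ} (ρ : SchwartzMap (Fin n → ℝ) ℝ)
    (hρ1 : ∫ x, ρ x = 1)
    (hρmom : ∀ α : Fin n → ℕ, 1 ≤ ∑ i, α i → ∫ x, (∏ i, (x i) ^ (α i)) * ρ x = 0)
    {g : (Fin n → ℝ) → ℝ} (hg : ContDiff ℝ (⊤ : ℕ∞) g) {B C : ℝ} (hB : ∀ y, ‖g y‖ ≤ B)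
    (hC : ∀ y, ‖iteratedFDeriv ℝ (m + 1) g y‖ ≤ C) (c : ℝ) (x : Fin n → ℝ) :
    |(∫ u, g (x + c • u) * ρ u) - g x| ≤
      C * (∫ u, ‖u‖ ^ (m + 1) * ‖ρ u‖) * |c| ^ (m + 1) := by
  let P (k : ℕ) (u : Fin n → ℝ) : ℝ :=
    ((k.factorial : ℝ)⁻¹) • iteratedFDeriv ℝ k g x (fun _ => c • u)
  have hP (k : ℕ) (u : Fin n → ℝ) : P k u * ρ u =
      ((k.factorial : ℝ)⁻¹ * c ^ k) * (iteratedFDeriv ℝ k g x (fun _ => u) * ρ u) := by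
    simp only [P]
    rw [(iteratedFDeriv ℝ k g x).map_smul_univ (fun _ => c)]
    simp
    ring
  have hPint (k : ℕ) : Integrable (fun u => P k u * ρ u) := by
    simp_rw [hP]
    exact (integrable_multilinear_diag_mul_schwartz ρ _).const_mul _
  have hgint : Integrable (fun u => g (x + c • u) * ρ u) :=
    ρ.integrable.bdd_mul (c := B) (by have := hg.continuous; fun_prop)
      (Filter.Eventually.of_forall fun u => hB _)
  have hPsum : ∫ u, (∑ k ∈ Finset.range (m + 1), P k u) * ρ u = g x := by
    simp_rw [Finset.sum_mul]
    rw [integral_finsetSum _ fun k _ => hPint k, Finset.sum_eq_single 0]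
    · simp [P, integral_const_mul, hρ1]
    · intro k _ hk
      simp_rw [hP]
      rw [integral_const_mul, integral_multilinear_diag_mul_schwartz_eq_zero
        (Nat.one_le_iff_ne_zero.mpr hk) ρ hρmom, mul_zero]
    · simp
  have hsumint : Integrable (fun u => (∑ k ∈ Finset.range (m + 1), P k u) * ρ u) := by
    simp_rw [Finset.sum_mul]
    exact integrable_finsetSum _ fun k _ => hPint k
  conv_lhs => rw [← hPsum]
  rw [← integral_sub hgint hsumint, ← Real.norm_eq_abs]
  refine (norm_integral_le_of_norm_le
    ((ρ.integrable_pow_mul volume (m + 1)).const_mul (C * |c| ^ (m + 1)))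
    (Filter.Eventually.of_forall fun u => ?_)).trans_eq ?_
  · rw [← sub_mul, norm_mul]
    have h := norm_sub_taylor_le hg hC x (c • u)
    rw [norm_smul, Real.norm_eq_abs c, mul_pow] at h
    calc _ ≤ C * (|c| ^ (m + 1) * ‖u‖ ^ (m + 1)) * ‖ρ u‖ := by gcongr
      _ = _ := by ring
  · rw [integral_const_mul]
    ring

lemma contDiff_pDeriv {n : ℕ} (i : Fin n) {f : (Fin n → ℝ) → ℝ}
    (hf : ContDiff ℝ (⊤ : ℕ∞) f) : ContDiff ℝ (⊤ : ℕ∞) (pDeriv i f) :=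
  (hf.fderiv_right (m := (⊤ : ℕ∞)) (by simp)).clm_apply contDiff_const

lemma hasCompactSupport_pDeriv {n : ℕ} (i : Fin n) {f : (Fin n → ℝ) → ℝ}
    (hf : HasCompactSupport f) : HasCompactSupport (pDeriv i f) :=
  hf.fderiv_apply (𝕜 := ℝ) _

/-- Iterated partial derivatives preserve smoothness and compactness of the support. -/
lemma contDiff_multiDeriv_and_hasCompactSupport {n : ℕ} (l : List (Fin n))
    {f : (Fin n → ℝ) → ℝ} (hf : ContDiff ℝ (⊤ : ℕ∞) f) (hfc : HasCompactSupport f) :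
    ContDiff ℝ (⊤ : ℕ∞) (multiDeriv l f) ∧ HasCompactSupport (multiDeriv l f) := by
  induction l generalizing f with
  | nil => exact ⟨hf, hfc⟩
  | cons i l ih => exact ih (contDiff_pDeriv i hf) (hasCompactSupport_pDeriv i hfc)

/-- Partial derivatives commute with convolution by a locally integrable kernel. -/
lemma pDeriv_integral_sub_mul {n : ℕ} (i : Fin n) {f κ : (Fin n → ℝ) → ℝ}
    (hf : ContDiff ℝ (⊤ : ℕ∞) f) (hfc : HasCompactSupport f) (hκ : LocallyIntegrable κ) :
    pDeriv i (fun y => ∫ t, f (y - t) * κ t) = fun y => ∫ t, pDeriv i f (y - t) * κ t := by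
  have hconv (h : (Fin n → ℝ) → ℝ) : (fun y => ∫ t, h (y - t) * κ t) =
      convolution κ h (ContinuousLinearMap.mul ℝ ℝ) volume := by
    ext y
    simp [convolution_def, mul_comm]
  rw [hconv, hconv]
  ext x
  have hf1 : ContDiff ℝ 1 f := hf.of_le (by exact_mod_cast le_top)
  rw [pDeriv, (hfc.hasFDerivAt_convolution_right (ContinuousLinearMap.mul ℝ ℝ) hκ hf1 x).fderiv,
    convolution_precompR_apply _ hκ (hfc.fderiv (𝕜 := ℝ)) (hf1.continuous_fderiv one_ne_zero)]
  rfl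

/-- Iterated partial derivatives commute with convolution by a locally integrable kernel. -/
lemma multiDeriv_integral_sub_mul {n : ℕ} (l : List (Fin n)) {f κ : (Fin n → ℝ) → ℝ}
    (hf : ContDiff ℝ (⊤ : ℕ∞) f) (hfc : HasCompactSupport f) (hκ : LocallyIntegrable κ) :
    multiDeriv l (fun y => ∫ t, f (y - t) * κ t) =
      fun y => ∫ t, multiDeriv l f (y - t) * κ t := by
  induction l generalizing f with
  | nil => rfl
  | cons i l ih =>
    rw [multiDeriv, pDeriv_integral_sub_mul i hf hfc hκ,
      ih (contDiff_pDeriv i hf) (hasCompactSupport_pDeriv i hfc)]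
    rfl

lemma integral_sub_mul_scaled {n : ℕ} (g ρ : (Fin n → ℝ) → ℝ) {c : ℝ} (hc : 0 < c)
    (x : Fin n → ℝ) :
    ∫ t, g (x - t) * (c ^ n * ρ (c • t)) = ∫ u, g (x + (-c⁻¹) • u) * ρ u := by
  have h := Measure.integral_comp_smul (volume : Measure (Fin n → ℝ))
    (fun u => g (x + (-c⁻¹) • u) * ρ u) c
  have hleft : (fun t => g (x - t) * (c ^ n * ρ (c • t))) =
      fun t => c ^ n * (g (x + (-c⁻¹) • (c • t)) * ρ (c • t)) := by
    ext t
    rw [smul_smul, neg_mul, inv_mul_cancel₀ hc.ne', neg_one_smul, ← sub_eq_add_neg]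
    ring
  rw [hleft, integral_const_mul, h, Module.finrank_fin_fun, abs_of_pos (by positivity),
    smul_eq_mul, ← mul_assoc, mul_inv_cancel₀ (by positivity), one_mul]

lemma abs_supAbsOn_le {X : Type*} {K : Set X} {f : X → ℝ} {C : ℝ} (hC : 0 ≤ C)
    (h : ∀ x, |f x| ≤ C) : |supAbsOn K f| ≤ C := by
  have h0 : 0 ≤ supAbsOn K f := Real.sSup_nonneg (by rintro _ ⟨x, _, rfl⟩; exact abs_nonneg _)
  rw [abs_of_nonneg h0]
  exact Real.sSup_le (by rintro _ ⟨x, _, rfl⟩; exact h x) hC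

/-- for a mollifier with vanishing moments, `f ∗ ρ_ε − f` is
negligible with respect to the powers of `b` (computation (4.3) of the paper,
i.e. `i₀|_{𝒟(Ω)} = σ`). -/
theorem convolution_minus_f_negligible {I : Type*} [Preorder I]
    (S : SetOfIndices I) {n : ℕ}
    (b : I → ℝ) (hbpos : ∀ ε, 0 < b ε) (hb : limPInf S b)
    (ρ : SchwartzMap (Fin n → ℝ) ℝ) (hρ1 : ∫ x, ρ x = 1)
    (hρmom : ∀ α : Fin n → ℕ, 1 ≤ ∑ i, α i →
      ∫ x, (∏ i, (x i) ^ (α i)) * ρ x = 0)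
    (f : (Fin n → ℝ) → ℝ) (hf : ContDiff ℝ (⊤ : ℕ∞) f) (hfc : HasCompactSupport f)
    (K : Set (Fin n → ℝ)) (hK : IsCompact K) (l : List (Fin n)) (m : ℕ) :
    BigO S
      (fun ε => supAbsOn K (fun x =>
        multiDeriv l (fun y => ∫ t, f (y - t) * ((b ε) ^ n * ρ (b ε • t))) x -
          multiDeriv l f x))
      (fun ε => ((b ε) ^ m)⁻¹) := by
  set g := multiDeriv l f with hgdef
  obtain ⟨hg, hgc⟩ := contDiff_multiDeriv_and_hasCompactSupport l hf hfc
  obtain ⟨B, hB⟩ := hgc.exists_bound_of_continuous hg.continuous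
  obtain ⟨C, hC⟩ := (hgc.iteratedFDeriv (𝕜 := ℝ) (m + 1)).exists_bound_of_continuous
    (hg.continuous_iteratedFDeriv (m := m + 1) (by exact_mod_cast le_top))
  have hC0 : 0 ≤ C := (norm_nonneg _).trans (hC 0)
  set D := C * ∫ u, ‖u‖ ^ (m + 1) * ‖ρ u‖
  have hD0 : 0 ≤ D := mul_nonneg hC0 (integral_nonneg fun u => by positivity)
  obtain ⟨A, hA, hlim⟩ := hb
  refine ⟨A, hA, fun a ha => ?_⟩
  obtain ⟨a₀, ha₀, hlarge⟩ := hlim a ha 1 one_pos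
  obtain ⟨ε₀, hε₀A, hε₀⟩ := (S.downward A hA a ha a₀ ha₀).1
  refine ⟨D + 1, by positivity, ε₀, hε₀A, hε₀.trans ha₀, fun ε hε hεε₀ => ?_⟩
  have hbε : 1 < b ε := hlarge ε hε (hεε₀.trans hε₀)
  have hb0 := hbpos ε
  refine abs_supAbsOn_le (by positivity) fun x => ?_
  have hκ : LocallyIntegrable (fun t => b ε ^ n * ρ (b ε • t)) :=
    Continuous.locallyIntegrable (by have := ρ.continuous; fun_prop)
  rw [multiDeriv_integral_sub_mul l hf hfc hκ, ← hgdef]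
  beta_reduce
  rw [integral_sub_mul_scaled g ρ hb0]
  refine (abs_integral_scaled_sub_le ρ hρ1 hρmom hg hB hC _ x).trans ?_
  have hpow : |-(b ε)⁻¹| ^ (m + 1) ≤ |(b ε ^ m)⁻¹| := by
    rw [abs_neg, abs_of_pos (by positivity), abs_of_pos (by positivity), ← inv_pow]
    exact pow_le_pow_of_le_one (by positivity) (inv_le_one_of_one_le₀ hbε.le) (Nat.le_succ m)
  gcongr
  exact le_add_of_nonneg_right zero_le_one
end
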